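/- (Sobolev–Stein embedding for the Grushin gradient.) Let 1 < p < Q and set p* = Qp/(Q−p). Then there exists a constant C > 0, depending only on p, μ and Q, such that for every u ∈ C_0^∞(ℝ^{d+k}): (∫_{ℝ^{d+k}} |u|^{p*} dx dy)^{1/p*} ≤ C (∫_{ℝ^{d+k}} |∇_μ u|^p dx dy)^{1/p}. -/

import Mathlib

open MeasureTheory Real
open scoped RealInnerProductSpace ENNReal

/-- The anisotropic distance function `ρ(x,y) = (|x|^{2+2μ} + (1+μ)²|y|²)^{1/(2+2μ)}`. -/
noncomputable def grho (μ : ℝ) {d k : ℕ}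
    (z : EuclideanSpace ℝ (Fin d) × EuclideanSpace ℝ (Fin k)) : ℝ :=
  (‖z.1‖ ^ (2 + 2 * μ) + (1 + μ) ^ 2 * ‖z.2‖ ^ 2) ^ (1 / (2 + 2 * μ))

/-- The Grushin gradient `∇_μ u = (∇_x u, |x|^μ ∇_y u)`. -/
noncomputable def gradMu (μ : ℝ) {d k : ℕ}
    (u : EuclideanSpace ℝ (Fin d) × EuclideanSpace ℝ (Fin k) → ℝ)
    (z : EuclideanSpace ℝ (Fin d) × EuclideanSpace ℝ (Fin k)) :
    EuclideanSpace ℝ (Fin d) × EuclideanSpace ℝ (Fin k) :=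
  (gradient (fun x => u (x, z.2)) z.1, (‖z.1‖ ^ μ) • gradient (fun y => u (z.1, y)) z.2)

/-- The Euclidean-type norm `((|v₁|² + |v₂|²))^{1/2}` of a pair. -/
noncomputable def pairNorm {d k : ℕ}
    (v : EuclideanSpace ℝ (Fin d) × EuclideanSpace ℝ (Fin k)) : ℝ :=
  Real.sqrt (‖v.1‖ ^ 2 + ‖v.2‖ ^ 2)

/-- `|∇_μ u| = (|∇_x u|² + |x|^{2μ}|∇_y u|²)^{1/2}`. -/
noncomputable def gradMuNorm (μ : ℝ) {d k : ℕ}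
    (u : EuclideanSpace ℝ (Fin d) × EuclideanSpace ℝ (Fin k) → ℝ)
    (z : EuclideanSpace ℝ (Fin d) × EuclideanSpace ℝ (Fin k)) : ℝ :=
  pairNorm (gradMu μ u z)

open scoped NNReal

theorem rpow_le_rpow_one_add_add {a m : ℝ} (ha : 0 < a) (hm : 1 < m) {t τ : ℝ}
    (ht₀ : 0 ≤ t) (ht₁ : t ≤ 1) (hτ : 0 ≤ τ) :
    t ^ ((m + a) / (1 + a)) ≤
      2 ^ ((m + a) / (m - 1)) * (1 + τ) ^ (-((m + a) / (m - 1))) + τ ^ a * t ^ m := by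
  have hm' : 0 < m - 1 := by linarith
  have hq : 0 < (m + a) / (1 + a) := by positivity
  have hQ : 0 < (m + a) / (m - 1) := by positivity
  have hsplit : (2 : ℝ) ^ ((m + a) / (m - 1)) * (1 + τ) ^ (-((m + a) / (m - 1)))
      = (2 / (1 + τ)) ^ ((m + a) / (m - 1)) := by
    rw [Real.div_rpow (by norm_num) (by positivity), Real.rpow_neg (by positivity)]
    rfl
  rw [hsplit]
  rcases le_or_gt τ 1 with h1 | h1
  · have h2 : 1 ≤ (2 / (1 + τ)) ^ ((m + a) / (m - 1)) := by
      apply Real.one_le_rpow _ hQ.le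
      rw [le_div_iff₀ (by positivity)]
      linarith
    have h3 : t ^ ((m + a) / (1 + a)) ≤ 1 := Real.rpow_le_one ht₀ ht₁ hq.le
    have : 0 ≤ τ ^ a * t ^ m := by positivity
    linarith
  · have hτ' : 0 < τ := by linarith
    rcases ht₀.eq_or_lt with rfl | ht
    · rw [Real.zero_rpow hq.ne']
      positivity
    rcases le_or_gt (τ ^ (-((1 + a) / (m - 1)))) t with h2 | h2
    · have h3 : t ^ ((m + a) / (1 + a)) ≤ τ ^ a * t ^ m := by
        have h4 : τ ^ (-a) ≤ t ^ (a * (m - 1) / (1 + a)) := by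
          calc τ ^ (-a) = (τ ^ (-((1 + a) / (m - 1)))) ^ (a * (m - 1) / (1 + a)) := by
                rw [← Real.rpow_mul hτ]; congr 1; field_simp
            _ ≤ _ := by gcongr
        have h5 : 1 ≤ τ ^ a * t ^ (a * (m - 1) / (1 + a)) := by
          calc (1 : ℝ) = τ ^ a * τ ^ (-a) := by rw [← Real.rpow_add hτ']; simp
            _ ≤ _ := by gcongr
        calc t ^ ((m + a) / (1 + a))
            ≤ (τ ^ a * t ^ (a * (m - 1) / (1 + a))) * t ^ ((m + a) / (1 + a)) :=
              le_mul_of_one_le_left (by positivity) h5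
          _ = τ ^ a * t ^ m := by
              rw [mul_assoc, ← Real.rpow_add ht]; congr 2; field_simp; ring
      have : 0 ≤ (2 / (1 + τ)) ^ ((m + a) / (m - 1)) := by positivity
      linarith
    · have h3 : t ^ ((m + a) / (1 + a)) ≤ (2 / (1 + τ)) ^ ((m + a) / (m - 1)) := by
        calc t ^ ((m + a) / (1 + a))
            ≤ (τ ^ (-((1 + a) / (m - 1)))) ^ ((m + a) / (1 + a)) := by gcongr
          _ = (τ⁻¹) ^ ((m + a) / (m - 1)) := by
              rw [← Real.rpow_mul hτ, ← Real.rpow_neg_eq_inv_rpow]; congr 1; field_simp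
          _ ≤ _ := by
              gcongr
              rw [inv_eq_one_div, div_le_div_iff₀ hτ' (by positivity)]
              linarith
      have : 0 ≤ τ ^ a * t ^ m := by positivity
      linarith

/-- One-dimensional interpolation between a uniform bound and a weighted `L^m` bound. -/
theorem exists_lintegral_rpow_le_of_forall_le {a m : ℝ} (ha : 0 < a) (hm : 1 < m) :
    ∃ C : ℝ≥0, ∀ f : ℝ → ℝ≥0∞, Measurable f → ∀ G : ℝ≥0∞, (∀ s, f s ≤ G) →
      ∫⁻ s, f s ^ ((m + a) / (1 + a)) ≤
        C * (G ^ (a / (1 + a)) * (∫⁻ s, ‖s‖ₑ ^ a * f s ^ m) ^ (1 / (1 + a))) := by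
  have hm' : 0 < m - 1 := by linarith
  set q := (m + a) / (1 + a) with hq_def
  set Q := (m + a) / (m - 1) with hQ_def
  have hq : 0 < q := by positivity
  have hQ : 1 < Q := by rw [hQ_def, lt_div_iff₀ hm']; linarith
  set J : ℝ≥0∞ := ∫⁻ s : ℝ, ENNReal.ofReal ((1 + ‖s‖) ^ (-Q)) with hJ
  have hJ_top : J < ∞ := finite_integral_one_add_norm (by simpa using hQ)
  refine ⟨2 ^ Q * J.toNNReal + 1, fun f hf G hG ↦ ?_⟩
  set A := ∫⁻ s, ‖s‖ₑ ^ a * f s ^ m with hA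
  have hθ : 0 < 1 / (1 + a) := by positivity
  have hθ' : 0 < a / (1 + a) := by positivity
  rcases eq_or_ne G 0 with rfl | hG0
  · simp [fun s ↦ le_zero_iff.mp (hG s), hq]
  rcases eq_or_ne A 0 with hA0 | hA0
  · have h : ∀ᵐ s, f s = 0 := by
      rw [hA, lintegral_eq_zero_iff (by fun_prop)] at hA0
      filter_upwards [hA0, Measure.ae_ne volume (0 : ℝ)] with s hs hs0
      have hs' : (‖s‖ₑ ^ a = 0) ∨ (f s ^ m = 0) := by simpa using hs
      rcases hs' with h | h
      · rw [ENNReal.rpow_eq_zero_iff_of_pos ha] at h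
        simp [hs0] at h
      · rwa [ENNReal.rpow_eq_zero_iff_of_pos (by linarith)] at h
    rw [lintegral_congr_ae (g := fun _ ↦ 0) (by
      filter_upwards [h] with s hs; simp [hs, hq])]
    simp
  have hC : ((2 ^ Q * J.toNNReal + 1 : ℝ≥0) : ℝ≥0∞) ≠ 0 := by
    simp
  rcases eq_or_ne G ∞ with rfl | hGt
  · rw [ENNReal.top_rpow_of_pos hθ', ENNReal.top_mul, ENNReal.mul_top hC]
    · exact le_top
    · simp [hA0, (by positivity : 0 ≤ 1 + a)]
  rcases eq_or_ne A ∞ with hAt | hAt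
  · rw [hAt, ENNReal.top_rpow_of_pos hθ, ENNReal.mul_top, ENNReal.mul_top hC]
    · exact le_top
    · simp [hG0, hθ'.le]
  lift G to ℝ≥0 using hGt
  have hg : 0 < (G : ℝ) := by
    have : G ≠ 0 := by simpa using hG0
    positivity
  obtain ⟨α, hα⟩ : ∃ α : ℝ≥0, A = α := ⟨A.toNNReal, (ENNReal.coe_toNNReal hAt).symm⟩
  have hα0 : 0 < (α : ℝ) := by
    have : α ≠ 0 := by rintro rfl; simp [hα] at hA0
    positivity
  set R : ℝ := (α / (G : ℝ) ^ m) ^ (1 / (1 + a)) with hR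
  have hR0 : 0 < R := by positivity
  have hpt : ∀ s, f s ^ q ≤
      ENNReal.ofReal ((G : ℝ) ^ q * 2 ^ Q) * ENNReal.ofReal ((1 + ‖R⁻¹ * s‖) ^ (-Q))
        + ENNReal.ofReal ((G : ℝ) ^ (q - m) * R ^ (-a)) * (‖s‖ₑ ^ a * f s ^ m) := by
    intro s
    have hfs : f s ≠ ∞ := ne_top_of_le_ne_top (by simp) (hG s)
    obtain ⟨φ, hφ⟩ : ∃ φ : ℝ≥0, f s = φ := ⟨(f s).toNNReal, (ENNReal.coe_toNNReal hfs).symm⟩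
    have hφG : (φ : ℝ) ≤ G := by
      have := hG s
      rw [hφ] at this
      exact_mod_cast this
    have key := rpow_le_rpow_one_add_add ha hm (t := φ / G) (τ := ‖R⁻¹ * s‖) (by positivity)
      (by rw [div_le_one hg]; exact hφG) (norm_nonneg _)
    rw [← hq_def, ← hQ_def] at key
    have key2 : (φ : ℝ) ^ q ≤ ((G : ℝ) ^ q * 2 ^ Q) * ((1 + ‖R⁻¹ * s‖) ^ (-Q))
        + ((G : ℝ) ^ (q - m) * R ^ (-a)) * (‖s‖ ^ a * (φ : ℝ) ^ m) := by
      have h := mul_le_mul_of_nonneg_left key (a := (G : ℝ) ^ q) (by positivity)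
      rw [Real.div_rpow (by positivity) hg.le, Real.div_rpow (by positivity) hg.le,
        mul_div_cancel₀ _ (by positivity), norm_mul,
        Real.mul_rpow (by positivity) (by positivity)] at h
      refine h.trans (le_of_eq ?_)
      rw [norm_mul, Real.norm_of_nonneg (inv_nonneg.mpr hR0.le), Real.inv_rpow hR0.le,
        Real.rpow_neg hR0.le, Real.rpow_sub hg]
      field_simp
    rw [hφ]
    have e1 : (φ : ℝ≥0∞) ^ q = ENNReal.ofReal ((φ : ℝ) ^ q) := by
      rw [← ENNReal.ofReal_rpow_of_nonneg (by positivity) hq.le, ENNReal.ofReal_coe_nnreal]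
    have e2 : ‖s‖ₑ ^ a * (φ : ℝ≥0∞) ^ m = ENNReal.ofReal (‖s‖ ^ a * (φ : ℝ) ^ m) := by
      rw [ENNReal.ofReal_mul (by positivity),
        ← ENNReal.ofReal_rpow_of_nonneg (NNReal.coe_nonneg φ) (by linarith),
        ← ENNReal.ofReal_rpow_of_nonneg (norm_nonneg s) ha.le, ENNReal.ofReal_coe_nnreal,
        ofReal_norm]
    rw [e1, e2, ← ENNReal.ofReal_mul (by positivity), ← ENNReal.ofReal_mul (by positivity),
      ← ENNReal.ofReal_add (by positivity) (by positivity)]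
    exact ENNReal.ofReal_le_ofReal key2
  have hscale : ∫⁻ s : ℝ, ENNReal.ofReal ((1 + ‖R⁻¹ * s‖) ^ (-Q)) = ENNReal.ofReal R * J := by
    rw [← lintegral_map (f := fun s : ℝ ↦ ENNReal.ofReal ((1 + ‖s‖) ^ (-Q))) (by fun_prop)
      (by fun_prop), Real.map_volume_mul_left (by positivity), lintegral_smul_measure, inv_inv,
      abs_of_pos hR0, smul_eq_mul]
  calc ∫⁻ s, f s ^ q
      ≤ ENNReal.ofReal ((G : ℝ) ^ q * 2 ^ Q) * (ENNReal.ofReal R * J)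
        + ENNReal.ofReal ((G : ℝ) ^ (q - m) * R ^ (-a)) * A := by
        refine (lintegral_mono hpt).trans (le_of_eq ?_)
        rw [lintegral_add_left (by fun_prop), lintegral_const_mul _ (by fun_prop),
          lintegral_const_mul _ (by fun_prop), hscale]
    _ = ENNReal.ofReal ((2 ^ Q * (J.toNNReal : ℝ) + 1) * ((G : ℝ) ^ q * R)) := by
        have hJ' : J = ENNReal.ofReal (J.toNNReal : ℝ) := by
          rw [ENNReal.ofReal_coe_nnreal, ENNReal.coe_toNNReal hJ_top.ne]
        rw [hα, ← ENNReal.ofReal_coe_nnreal (p := α)]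
        nth_rewrite 1 [hJ']
        rw [← ENNReal.ofReal_mul hR0.le, ← ENNReal.ofReal_mul (by positivity),
          ← ENNReal.ofReal_mul (by positivity), ← ENNReal.ofReal_add (by positivity)
          (by positivity)]
        congr 1
        have hα' : (α : ℝ) = R ^ a * R * (G : ℝ) ^ m := by
          rw [← Real.rpow_add_one hR0.ne', hR, ← Real.rpow_mul (by positivity)]
          have : 1 / (1 + a) * (a + 1) = 1 := by field_simp; ring
          rw [this, Real.rpow_one]
          field_simp
        rw [hα', Real.rpow_sub hg, Real.rpow_neg hR0.le]
        field_simp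
    _ = _ := by
        rw [ENNReal.ofReal_mul (by positivity)]
        congr 1
        · rw [show (2 ^ Q * (J.toNNReal : ℝ) + 1) = ((2 ^ Q * J.toNNReal + 1 : ℝ≥0) : ℝ) by
            push_cast; rfl, ENNReal.ofReal_coe_nnreal]
        · rw [hα, ← ENNReal.ofReal_coe_nnreal (p := α), ← ENNReal.ofReal_coe_nnreal (p := G),
            ENNReal.ofReal_rpow_of_nonneg (by positivity) hθ.le,
            ENNReal.ofReal_rpow_of_nonneg (by positivity) hθ'.le,
            ← ENNReal.ofReal_mul (by positivity)]
          congr 1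
          rw [hR, Real.div_rpow (by positivity) (by positivity), ← Real.rpow_mul hg.le,
            mul_div_assoc', mul_comm, mul_div_assoc, ← Real.rpow_sub hg, mul_comm]
          congr 2
          rw [hq_def]; field_simp; ring

section
open Function Finset

theorem lintegral_pi_eq_lintegral_lintegral_update {ι : Type*} [Fintype ι] [DecidableEq ι]
    (i : ι) {F : (ι → ℝ) → ℝ≥0∞} (hF : Measurable F) :
    ∫⁻ x, F x = ∫⁻ y : (∀ _ : (Finset.erase univ i : Finset ι), ℝ),
      ∫⁻ t, F (update (updateFinset (0 : ι → ℝ) (univ.erase i) y) i t) := by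
  rw [volume_pi, lintegral_eq_lmarginal_univ 0, lmarginal_erase' _ hF (mem_univ i)]
  rfl

/-- A weighted grid-lines inequality: the weight `|x i₀| ^ μ` is attached to the directions in `S`.
It combines the Loomis–Whitney estimate with interpolation along the direction `i₀`. -/
theorem exists_lintegral_rpow_le_of_grushin_lines {ι : Type*} [Fintype ι] [DecidableEq ι]
    {i₀ : ι} {S : Finset ι} (hS : S.Nonempty) (hi₀ : i₀ ∉ S) {μ : ℝ} (hμ : 0 < μ) {Q : ℝ}
    (hQ : Q = Fintype.card ι + μ * #S) :
    ∃ C : ℝ≥0, ∀ f g : (ι → ℝ) → ℝ≥0∞, Measurable f → Measurable g →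
      (∀ x, ∀ i ∉ S, f x ≤ ∫⁻ t, g (update x i t)) →
      (∀ x, ∀ i ∈ S, ‖x i₀‖ₑ ^ μ * f x ≤ ∫⁻ t, g (update x i t)) →
      ∫⁻ x, f x ^ (Q / (Q - 1)) ≤ C * (∫⁻ x, g x) ^ (Q / (Q - 1)) := by
  obtain ⟨j, hj⟩ := hS
  have : Nontrivial ι := ⟨i₀, j, by rintro rfl; exact hi₀ hj⟩
  have hn : (1 : ℝ) < Fintype.card ι := by exact_mod_cast Fintype.one_lt_card
  have hk : (0 : ℝ) < #S := by exact_mod_cast card_pos.mpr ⟨j, hj⟩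
  set n : ℝ := (Fintype.card ι : ℝ) with hn_def
  set k : ℝ := (#S : ℝ) with hk_def
  have hn1 : 0 < n - 1 := by linarith
  have ha : 0 < μ * k / (n - 1) := by positivity
  have hm : 1 < n / (n - 1) := by rw [lt_div_iff₀ hn1]; linarith
  have hQ1 : 0 < Q - 1 := by rw [hQ]; have := mul_pos hμ hk; linarith
  set a := μ * k / (n - 1) with ha_def
  set m := n / (n - 1) with hm_def
  have h1a : 1 + a = (Q - 1) / (n - 1) := by rw [ha_def, hQ]; field_simp; ring
  have hqe : (m + a) / (1 + a) = Q / (Q - 1) := by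
    rw [h1a, ha_def, hm_def, ← add_div, ← hQ]; field_simp
  obtain ⟨C, hC⟩ := exists_lintegral_rpow_le_of_forall_le ha hm
  refine ⟨C, fun f g hf hg h1 h2 ↦ ?_⟩
  have hA : ∫⁻ x, ‖x i₀‖ₑ ^ a * f x ^ m ≤ (∫⁻ x, g x) ^ m := by
    have hp : Real.HolderConjugate (Fintype.card ι) m := by
      rw [hm_def, hn_def]; exact Real.HolderConjugate.conjExponent hn
    have hb : 0 < 1 / (n - 1) := by positivity
    refine le_trans (lintegral_mono fun x ↦ ?_)
      (lintegral_prod_lintegral_pow_le (fun _ : ι ↦ (volume : Measure ℝ)) hp hg)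
    calc ‖x i₀‖ₑ ^ a * f x ^ m
        = ∏ i, ((if i ∈ S then ‖x i₀‖ₑ ^ μ else 1) * f x) ^ (1 / (n - 1)) := by
          simp_rw [ENNReal.mul_rpow_of_nonneg _ _ hb.le, prod_mul_distrib, prod_const]
          congr 1
          · rw [ENNReal.prod_rpow_of_nonneg hb.le, prod_ite_mem, univ_inter, prod_const,
              ← ENNReal.rpow_natCast, ← ENNReal.rpow_mul, ← ENNReal.rpow_mul]
            congr 1
            rw [ha_def]; ring
          · rw [← ENNReal.rpow_natCast, ← ENNReal.rpow_mul, card_univ]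
            congr 1
            rw [hm_def]; ring
      _ ≤ _ := by
          refine prod_le_prod' fun i _ ↦ ENNReal.rpow_le_rpow ?_ hb.le
          split_ifs with h
          · exact h2 x i h
          · simpa using h1 x i h
  have hθ : 0 < 1 / (1 + a) := by positivity
  have hθ' : 0 < a / (1 + a) := by positivity
  set Y := fun y ↦ updateFinset (0 : ι → ℝ) (univ.erase i₀) y with hY
  have hYm : Measurable Y := measurable_updateFinset
  have hup : Measurable fun z : (_ → ℝ) × ℝ ↦ update (Y z.1) i₀ z.2 := by
    refine measurable_pi_iff.mpr fun i ↦ ?_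
    by_cases h : i = i₀
    · subst h; simpa using measurable_snd
    · simp only [update_of_ne h]
      exact (measurable_pi_apply i).comp (hYm.comp measurable_fst)
  calc ∫⁻ x, f x ^ (Q / (Q - 1))
      = ∫⁻ y, ∫⁻ t, f (update (Y y) i₀ t) ^ (Q / (Q - 1)) :=
        lintegral_pi_eq_lintegral_lintegral_update i₀ (by fun_prop)
    _ ≤ ∫⁻ y, C * ((∫⁻ t, g (update (Y y) i₀ t)) ^ (a / (1 + a)) *
          (∫⁻ t, ‖t‖ₑ ^ a * f (update (Y y) i₀ t) ^ m) ^ (1 / (1 + a))) := by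
        refine lintegral_mono fun y ↦ ?_
        rw [← hqe]
        refine hC _ (hf.comp (measurable_update _)) _ fun s ↦ ?_
        simpa using h1 (update (Y y) i₀ s) i₀ hi₀
    _ ≤ C * ((∫⁻ x, g x) ^ (a / (1 + a)) *
          (∫⁻ x, ‖x i₀‖ₑ ^ a * f x ^ m) ^ (1 / (1 + a))) := by
        have hm1 : Measurable fun y ↦ ∫⁻ t, g (update (Y y) i₀ t) :=
          (hg.comp hup).lintegral_prod_right'
        have hm2 : Measurable fun y ↦ ∫⁻ t, ‖t‖ₑ ^ a * f (update (Y y) i₀ t) ^ m :=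
          Measurable.lintegral_prod_right' (f := fun z : (_ → ℝ) × ℝ ↦
            ‖z.2‖ₑ ^ a * f (update (Y z.1) i₀ z.2) ^ m)
            ((measurable_snd.enorm.pow_const _).mul ((hf.comp hup).pow_const _))
        rw [lintegral_const_mul _ (by fun_prop)]
        gcongr
        rw [lintegral_pi_eq_lintegral_lintegral_update i₀ hg,
          lintegral_pi_eq_lintegral_lintegral_update i₀ (F := fun x ↦ ‖x i₀‖ₑ ^ a * f x ^ m)
            (by fun_prop)]
        simp only [update_self]
        exact ENNReal.lintegral_mul_norm_pow_le hm1.aemeasurable hm2.aemeasurable hθ'.le hθ.le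
          (by field_simp; ring)
    _ ≤ C * ((∫⁻ x, g x) ^ (a / (1 + a)) * ((∫⁻ x, g x) ^ m) ^ (1 / (1 + a))) := by gcongr
    _ = C * (∫⁻ x, g x) ^ (Q / (Q - 1)) := by
        rw [← ENNReal.rpow_mul, ← ENNReal.rpow_add_of_nonneg _ _ hθ'.le (by positivity), ← hqe]
        congr 2
        field_simp
        ring
end

section
open Function

theorem enorm_rpow_le_lintegral_update {ι : Type*} [Fintype ι] [DecidableEq ι]
    {u : (ι → ℝ) → ℝ} (hu : ContDiff ℝ 1 u) (h2u : HasCompactSupport u) {γ : ℝ≥0} (hγ : 1 < γ)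
    (x : ι → ℝ) (i : ι) :
    ‖u x‖ₑ ^ (γ : ℝ) ≤ ∫⁻ t, γ * ‖u (update x i t)‖ₑ ^ ((γ : ℝ) - 1) *
      ‖fderiv ℝ u (update x i t) (Pi.single i 1)‖ₑ := by
  have hγ' : (1 : ℝ) < γ := by exact_mod_cast hγ
  set φ : ℝ → ℝ := u ∘ update x i with hφ
  have hφ1 : ContDiff ℝ 1 φ := hu.comp (by convert! contDiff_update 1 x i)
  have hφ2 : HasCompactSupport φ := h2u.comp_isClosedEmbedding (isClosedEmbedding_update x i)
  have hψ : HasCompactSupport (fun t ↦ ‖φ t‖ ^ (γ : ℝ)) :=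
    hφ2.comp_left (g := fun s : ℝ ↦ ‖s‖ ^ (γ : ℝ)) (by
      simp [Real.zero_rpow (by linarith : (γ : ℝ) ≠ 0)])
  calc ‖u x‖ₑ ^ (γ : ℝ) = ‖‖φ (x i)‖ ^ (γ : ℝ)‖ₑ := by
        rw [Real.enorm_rpow_of_nonneg (norm_nonneg _) (by positivity), enorm_norm]
        simp [hφ]
    _ ≤ ∫⁻ t in Set.Iic (x i), ‖deriv (fun t ↦ ‖φ t‖ ^ (γ : ℝ)) t‖ₑ :=
        hψ.enorm_le_lintegral_Ici_deriv (hφ1.norm_rpow hγ') (x i)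
    _ ≤ ∫⁻ t, ‖deriv (fun t ↦ ‖φ t‖ ^ (γ : ℝ)) t‖ₑ := setLIntegral_le_lintegral _ _
    _ ≤ _ := by
        refine lintegral_mono fun t ↦ ?_
        have h1 := enorm_fderiv_norm_rpow_le (hφ1.differentiable one_ne_zero) (x := t) hγ
        have h2 : ∀ h : ℝ → ℝ, ‖fderiv ℝ h t‖ₑ = ‖deriv h t‖ₑ := fun h ↦ by
          rw [← ofReal_norm, ← ofReal_norm, norm_deriv_eq_norm_fderiv]
        rw [h2, h2] at h1
        refine h1.trans (le_of_eq ?_)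
        rw [hφ, fderiv_comp_deriv _ (hu.differentiable one_ne_zero).differentiableAt
          (hasDerivAt_update x i t).differentiableAt, (hasDerivAt_update x i t).deriv]
        rfl
end

/-- Coordinates on the product of two Euclidean spaces, indexed by a disjoint union. -/
noncomputable def euclideanProdCoords (d k : ℕ) :
    (Fin d ⊕ Fin k → ℝ) ≃L[ℝ] EuclideanSpace ℝ (Fin d) × EuclideanSpace ℝ (Fin k) :=
  (ContinuousLinearEquiv.sumPiEquivProdPi ℝ (Fin d) (Fin k) (fun _ ↦ ℝ)).trans
    ((PiLp.continuousLinearEquiv 2 ℝ (fun _ : Fin d ↦ ℝ)).symm.prodCongr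
      (PiLp.continuousLinearEquiv 2 ℝ (fun _ : Fin k ↦ ℝ)).symm)

theorem euclideanProdCoords_fst_apply {d k : ℕ} (x : Fin d ⊕ Fin k → ℝ) (i : Fin d) :
    (euclideanProdCoords d k x).1 i = x (Sum.inl i) := rfl

theorem euclideanProdCoords_single_inl {d k : ℕ} (i : Fin d) :
    euclideanProdCoords d k (Pi.single (Sum.inl i) 1) = (EuclideanSpace.single i 1, 0) := by
  ext j
  · simp [euclideanProdCoords, ContinuousLinearEquiv.sumPiEquivProdPi,
      LinearEquiv.sumPiEquivProdPi, Equiv.sumPiEquivProdPi, Pi.single_apply]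
  · simp [euclideanProdCoords, ContinuousLinearEquiv.sumPiEquivProdPi,
      LinearEquiv.sumPiEquivProdPi, Equiv.sumPiEquivProdPi]

theorem euclideanProdCoords_single_inr {d k : ℕ} (i : Fin k) :
    euclideanProdCoords d k (Pi.single (Sum.inr i) 1) = (0, EuclideanSpace.single i 1) := by
  ext j
  · simp [euclideanProdCoords, ContinuousLinearEquiv.sumPiEquivProdPi,
      LinearEquiv.sumPiEquivProdPi, Equiv.sumPiEquivProdPi]
  · simp [euclideanProdCoords, ContinuousLinearEquiv.sumPiEquivProdPi,
      LinearEquiv.sumPiEquivProdPi, Equiv.sumPiEquivProdPi, Pi.single_apply]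

theorem measurePreserving_euclideanProdCoords (d k : ℕ) :
    MeasurePreserving (euclideanProdCoords d k) volume volume :=
  ((PiLp.volume_preserving_toLp (Fin d)).prod (PiLp.volume_preserving_toLp (Fin k))).comp
    (volume_measurePreserving_sumPiEquivProdPi (fun _ : Fin d ⊕ Fin k ↦ ℝ))

section GradMuNorm

variable {μ : ℝ} {d k : ℕ} {u : EuclideanSpace ℝ (Fin d) × EuclideanSpace ℝ (Fin k) → ℝ}

theorem gradMuNorm_eq (hu : Differentiable ℝ u)
    (z : EuclideanSpace ℝ (Fin d) × EuclideanSpace ℝ (Fin k)) :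
    gradMuNorm μ u z =
      √(‖(fderiv ℝ u z).comp (ContinuousLinearMap.inl ℝ _ _)‖ ^ 2 +
        (‖z.1‖ ^ μ * ‖(fderiv ℝ u z).comp (ContinuousLinearMap.inr ℝ _ _)‖) ^ 2) := by
  have h1 : HasFDerivAt (fun x ↦ u (x, z.2))
      ((fderiv ℝ u z).comp (ContinuousLinearMap.inl ℝ _ _)) z.1 :=
    HasFDerivAt.comp z.1 (g := u) (hu z).hasFDerivAt (hasFDerivAt_prodMk_left z.1 z.2)
  have h2 : HasFDerivAt (fun y ↦ u (z.1, y))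
      ((fderiv ℝ u z).comp (ContinuousLinearMap.inr ℝ _ _)) z.2 :=
    HasFDerivAt.comp z.2 (g := u) (hu z).hasFDerivAt (hasFDerivAt_prodMk_right z.1 z.2)
  simp only [gradMuNorm, pairNorm, gradMu, gradient, h1.fderiv, h2.fderiv, norm_smul,
    LinearIsometryEquiv.norm_map, Real.norm_of_nonneg (Real.rpow_nonneg (norm_nonneg z.1) μ)]

theorem gradMuNorm_nonneg (z : EuclideanSpace ℝ (Fin d) × EuclideanSpace ℝ (Fin k)) :
    0 ≤ gradMuNorm μ u z :=
  Real.sqrt_nonneg _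

theorem continuous_gradMuNorm (hμ : 0 < μ) (hu : ContDiff ℝ 1 u) :
    Continuous (gradMuNorm μ u) := by
  have hd : Continuous (fderiv ℝ u) := hu.continuous_fderiv one_ne_zero
  rw [funext (gradMuNorm_eq (μ := μ) (hu.differentiable one_ne_zero))]
  have : Continuous fun z : EuclideanSpace ℝ (Fin d) × EuclideanSpace ℝ (Fin k) ↦ ‖z.1‖ ^ μ :=
    continuous_fst.norm.rpow_const fun _ ↦ Or.inr hμ.le
  fun_prop

theorem hasCompactSupport_gradMuNorm (hu : Differentiable ℝ u) (h2u : HasCompactSupport u) :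
    HasCompactSupport (gradMuNorm μ u) := by
  refine (h2u.fderiv ℝ).mono fun z hz ↦ ?_
  contrapose! hz
  simp only [Function.mem_support, not_not] at hz ⊢
  simp [gradMuNorm_eq hu, hz]

theorem abs_fderiv_inl_single_le_gradMuNorm (hu : Differentiable ℝ u)
    (z : EuclideanSpace ℝ (Fin d) × EuclideanSpace ℝ (Fin k)) (i : Fin d) :
    |fderiv ℝ u z (EuclideanSpace.single i 1, 0)| ≤ gradMuNorm μ u z := by
  rw [gradMuNorm_eq hu]
  refine Real.le_sqrt_of_sq_le ?_
  have h := ((fderiv ℝ u z).comp (ContinuousLinearMap.inl ℝ _ _)).le_opNorm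
    (EuclideanSpace.single i (1 : ℝ))
  simp only [PiLp.norm_single, norm_one, mul_one] at h
  have h' := pow_le_pow_left₀ (norm_nonneg _) h 2
  exact h'.trans (le_add_of_nonneg_right (sq_nonneg _))

theorem rpow_norm_mul_abs_fderiv_inr_single_le_gradMuNorm (hu : Differentiable ℝ u)
    (z : EuclideanSpace ℝ (Fin d) × EuclideanSpace ℝ (Fin k)) (i : Fin k) :
    ‖z.1‖ ^ μ * |fderiv ℝ u z (0, EuclideanSpace.single i 1)| ≤ gradMuNorm μ u z := by
  rw [gradMuNorm_eq hu]
  refine Real.le_sqrt_of_sq_le ?_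
  have h := ((fderiv ℝ u z).comp (ContinuousLinearMap.inr ℝ _ _)).le_opNorm
    (EuclideanSpace.single i (1 : ℝ))
  simp only [PiLp.norm_single, norm_one, mul_one] at h
  have h' := pow_le_pow_left₀ (by positivity) (mul_le_mul_of_nonneg_left h
    (Real.rpow_nonneg (norm_nonneg z.1) μ)) 2
  exact h'.trans (le_add_of_nonneg_left (sq_nonneg _))

end GradMuNorm

section
open Function

/-- The Sobolev inequality for the exponent `1`, applied to `|u| ^ γ`. -/
theorem exists_lintegral_enorm_rpow_le_lintegral_gradMuNorm {d k : ℕ} (hd : 1 ≤ d) (hk : 1 ≤ k)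
    {μ : ℝ} (hμ : 0 < μ) {Q : ℝ} (hQ : Q = d + (1 + μ) * k) :
    ∃ C : ℝ≥0, ∀ u : EuclideanSpace ℝ (Fin d) × EuclideanSpace ℝ (Fin k) → ℝ,
      ContDiff ℝ 1 u → HasCompactSupport u → ∀ γ : ℝ≥0, 1 < γ →
      ∫⁻ z, ‖u z‖ₑ ^ (γ * (Q / (Q - 1))) ≤
        C * (∫⁻ z, γ * ‖u z‖ₑ ^ ((γ : ℝ) - 1) * ENNReal.ofReal (gradMuNorm μ u z))
          ^ (Q / (Q - 1)) := by
  obtain ⟨C, hC⟩ := exists_lintegral_rpow_le_of_grushin_lines (ι := Fin d ⊕ Fin k)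
    (i₀ := Sum.inl ⟨0, hd⟩) (S := Finset.univ.image Sum.inr) (Q := Q)
    ⟨Sum.inr ⟨0, hk⟩, by simp⟩ (by simp) hμ
    (by rw [Finset.card_image_of_injective _ Sum.inr_injective, hQ]; simp; ring)
  refine ⟨C, fun u hu h2u γ hγ ↦ ?_⟩
  set T := euclideanProdCoords d k with hT
  have hTm := measurePreserving_euclideanProdCoords d k
  have hγ' : (1 : ℝ) < γ := by exact_mod_cast hγ
  have hN : Measurable (gradMuNorm μ u) := (continuous_gradMuNorm hμ hu).measurable
  have hud := hu.differentiable one_ne_zero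
  have hum : Measurable u := hu.continuous.measurable
  have hline := enorm_rpow_le_lintegral_update (u := u ∘ T) (hu.comp T.contDiff)
    (h2u.comp_homeomorph T.toHomeomorph) hγ
  have hfd : ∀ x v, fderiv ℝ (u ∘ T) x v = fderiv ℝ u (T x) (T v) := fun x v ↦ by
    rw [T.comp_right_fderiv]; rfl
  simp only [hfd, Function.comp_apply] at hline
  have key := hC (fun x ↦ ‖u (T x)‖ₑ ^ (γ : ℝ))
    (fun x ↦ γ * ‖u (T x)‖ₑ ^ ((γ : ℝ) - 1) * ENNReal.ofReal (gradMuNorm μ u (T x)))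
    ((hum.comp hTm.measurable).enorm.pow_const _)
    (((((hum.comp hTm.measurable).enorm.pow_const _)).const_mul _).mul
      (hN.comp hTm.measurable).ennreal_ofReal) ?_ ?_
  · rw [← hTm.lintegral_comp (by fun_prop), ← hTm.lintegral_comp (by fun_prop)]
    simpa only [ENNReal.rpow_mul] using key
  · rintro x (i | i) hi
    · refine (hline x (Sum.inl i)).trans (lintegral_mono fun t ↦ ?_)
      gcongr
      rw [hT, euclideanProdCoords_single_inl, ← ofReal_norm]
      exact ENNReal.ofReal_le_ofReal (abs_fderiv_inl_single_le_gradMuNorm hud _ i)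
    · simp at hi
  · rintro x (i | i) hi
    · simp at hi
    · refine (mul_le_mul_right (hline x (Sum.inr i)) _).trans ?_
      rw [← lintegral_const_mul' _ _ (by simp [hμ.le])]
      refine lintegral_mono fun t ↦ ?_
      rw [mul_left_comm]
      gcongr
      rw [hT, euclideanProdCoords_single_inr, ← ofReal_norm, ← ofReal_norm,
        ENNReal.ofReal_rpow_of_nonneg (norm_nonneg _) hμ.le, ← ENNReal.ofReal_mul (by positivity)]
      refine ENNReal.ofReal_le_ofReal (le_trans ?_
        (rpow_norm_mul_abs_fderiv_inr_single_le_gradMuNorm hud _ i))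
      refine mul_le_mul_of_nonneg_right (Real.rpow_le_rpow (norm_nonneg _) ?_ hμ.le)
        (abs_nonneg _)
      have h := PiLp.norm_apply_le
        (euclideanProdCoords d k (update x (Sum.inr i) t)).1 ⟨0, hd⟩
      rwa [euclideanProdCoords_fst_apply, update_of_ne (by simp)] at h
end

/-- Sobolev–Stein embedding for the Grushin gradient. -/
theorem sobolev_stein_embedding_grushin
    (d k : ℕ) (hd : 1 ≤ d) (hk : 1 ≤ k) (μ : ℝ) (hμ : 0 < μ)
    (Q : ℝ) (hQ : Q = d + (1 + μ) * k)
    (p : ℝ) (hp1 : 1 < p) (hpQ : p < Q) :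
    ∃ C : ℝ, 0 < C ∧
      ∀ u : EuclideanSpace ℝ (Fin d) × EuclideanSpace ℝ (Fin k) → ℝ,
        ContDiff ℝ (⊤ : ℕ∞) u → HasCompactSupport u →
        (∫ z, |u z| ^ (Q * p / (Q - p))) ^ ((Q - p) / (Q * p))
          ≤ C * (∫ z, gradMuNorm μ u z ^ p) ^ (1 / p) := by
  obtain ⟨C, hC⟩ := exists_lintegral_enorm_rpow_le_lintegral_gradMuNorm hd hk hμ hQ
  have hp0 : 0 < p := by linarith
  have hQ0 : 0 < Q := by linarith
  have hQ1 : 0 < Q - 1 := by linarith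
  have hQp : 0 < Q - p := by linarith
  obtain ⟨γ, hγ⟩ : ∃ γ : ℝ≥0, (γ : ℝ) = p * (Q - 1) / (Q - p) :=
    ⟨⟨p * (Q - 1) / (Q - p), by positivity⟩, rfl⟩
  have hγ1 : (1 : ℝ) < γ := by
    rw [hγ, lt_div_iff₀ hQp]
    nlinarith
  have hγ0 : (0 : ℝ) < γ := by linarith
  have hr0 : 0 < Q * p / (Q - p) := by positivity
  have hq0 : 0 < Q / (Q - 1) := by positivity
  have hp' : 0 < 1 - 1 / p := by rw [sub_pos, div_lt_one hp0]; exact hp1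
  refine ⟨(C : ℝ) ^ ((Q - 1) / Q) * γ + 1, by positivity, fun u hu h2u ↦ ?_⟩
  have hu1 : ContDiff ℝ 1 u := hu.of_le (by exact_mod_cast le_top)
  have hNc := continuous_gradMuNorm hμ hu1
  have hNs := hasCompactSupport_gradMuNorm (μ := μ) (hu1.differentiable one_ne_zero) h2u
  have hUi : Integrable (fun z ↦ |u z| ^ (Q * p / (Q - p))) :=
    Continuous.integrable_of_hasCompactSupport
      (hu1.continuous.abs.rpow_const fun _ ↦ Or.inr hr0.le)
      (h2u.comp_left (g := fun s : ℝ ↦ |s| ^ (Q * p / (Q - p)))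
        (by simp [Real.zero_rpow hr0.ne']))
  have hPi : Integrable (fun z ↦ gradMuNorm μ u z ^ p) :=
    Continuous.integrable_of_hasCompactSupport (hNc.rpow_const fun _ ↦ Or.inr hp0.le)
      (hNs.comp_left (g := fun s : ℝ ↦ s ^ p) (by simp [Real.zero_rpow hp0.ne']))
  set U := ∫ z, |u z| ^ (Q * p / (Q - p)) with hU
  set P := ∫ z, gradMuNorm μ u z ^ p with hP
  have hU0 : 0 ≤ U := integral_nonneg fun z ↦ by positivity
  have hP0 : 0 ≤ P := integral_nonneg fun z ↦ Real.rpow_nonneg (gradMuNorm_nonneg z) p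
  have hUl : ENNReal.ofReal U = ∫⁻ z, ‖u z‖ₑ ^ (Q * p / (Q - p)) := by
    rw [hU, ofReal_integral_eq_lintegral_ofReal hUi (ae_of_all _ fun z ↦ by positivity)]
    refine lintegral_congr fun z ↦ ?_
    rw [← ENNReal.ofReal_rpow_of_nonneg (abs_nonneg _) hr0.le, ← Real.norm_eq_abs, ofReal_norm]
  have hPl : ENNReal.ofReal P = ∫⁻ z, ENNReal.ofReal (gradMuNorm μ u z) ^ p := by
    rw [hP, ofReal_integral_eq_lintegral_ofReal hPi
      (ae_of_all _ fun z ↦ Real.rpow_nonneg (gradMuNorm_nonneg z) p)]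
    refine lintegral_congr fun z ↦ ?_
    rw [← ENNReal.ofReal_rpow_of_nonneg (gradMuNorm_nonneg z) hp0.le]
  have hmain : U ≤ C * (γ * (U ^ (1 - 1 / p) * P ^ (1 / p))) ^ (Q / (Q - 1)) := by
    have hum : Measurable u := hu1.continuous.measurable
    have hNm : Measurable (gradMuNorm μ u) := hNc.measurable
    have h := hC u hu1 h2u γ (by exact_mod_cast hγ1)
    have hholder : ∫⁻ z, γ * ‖u z‖ₑ ^ ((γ : ℝ) - 1) * ENNReal.ofReal (gradMuNorm μ u z)
        ≤ γ * (ENNReal.ofReal U ^ (1 - 1 / p) * ENNReal.ofReal P ^ (1 / p)) := by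
      simp_rw [mul_assoc]
      rw [lintegral_const_mul _ (by fun_prop), hUl, hPl]
      gcongr
      refine le_trans (le_of_eq (lintegral_congr fun z ↦ ?_))
        (ENNReal.lintegral_mul_norm_pow_le (by fun_prop) (by fun_prop) hp'.le
          (by positivity) (by ring))
      rw [← ENNReal.rpow_mul, ← ENNReal.rpow_mul]
      congr 1
      · congr 1
        rw [hγ]; field_simp; ring
      · rw [mul_one_div_cancel hp0.ne', ENNReal.rpow_one]
    rw [show γ * (Q / (Q - 1)) = Q * p / (Q - p) by rw [hγ]; field_simp, ← hUl] at h
    have h2 := h.trans (mul_le_mul_right (ENNReal.rpow_le_rpow hholder hq0.le) _)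
    rw [ENNReal.ofReal_rpow_of_nonneg hU0 hp'.le,
      ENNReal.ofReal_rpow_of_nonneg hP0 (by positivity), ← ENNReal.ofReal_mul (by positivity),
      ← ENNReal.ofReal_coe_nnreal (p := γ), ← ENNReal.ofReal_coe_nnreal (p := C),
      ← ENNReal.ofReal_mul (by positivity), ENNReal.ofReal_rpow_of_nonneg (by positivity) hq0.le,
      ← ENNReal.ofReal_mul (by positivity)] at h2
    exact (ENNReal.ofReal_le_ofReal_iff (by positivity)).mp h2
  rcases hU0.eq_or_lt with hU00 | hUpos
  · rw [← hU00, Real.zero_rpow (by positivity)]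
    positivity
  have hroot : U ^ ((Q - 1) / Q) ≤
      (C : ℝ) ^ ((Q - 1) / Q) * γ * P ^ (1 / p) * U ^ (1 - 1 / p) := by
    refine (Real.rpow_le_rpow hU0 hmain (by positivity)).trans (le_of_eq ?_)
    rw [Real.mul_rpow (by positivity) (by positivity), ← Real.rpow_mul (by positivity),
      show Q / (Q - 1) * ((Q - 1) / Q) = 1 by field_simp, Real.rpow_one]
    ring
  calc U ^ ((Q - p) / (Q * p))
      = U ^ ((Q - 1) / Q) / U ^ (1 - 1 / p) := by
        rw [← Real.rpow_sub hUpos]; congr 1; field_simp; ring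
    _ ≤ (C : ℝ) ^ ((Q - 1) / Q) * γ * P ^ (1 / p) := by
        rwa [div_le_iff₀ (by positivity)]
    _ ≤ ((C : ℝ) ^ ((Q - 1) / Q) * γ + 1) * P ^ (1 / p) := by
        gcongr
        linarith
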